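/- arXiv:2602.10741 — 2 statements merged into one kernel-verified Lean document; each statement's English description precedes it below -/
import Mathlib

section
/- Let n ≥ 2 and let a(t,x) satisfy Assumption (A). Let 0 < p < 1, a ≥ 1, t₀ > 0, x₀, ξ₀ ∈ ℝⁿ, let K be a relatively compact neighborhood of x₀ and Γ a conic neighborhood of ξ₀. Then there exists λ₀ > 0 such that for all λ ≥ λ₀, all s with λ^{p−1} ≤ |s − t₀| ≤ t₀, all x ∈ K and all ξ ∈ Γ_a, the Hamiltonian trajectory satisfies (1/(2a)) |s − t₀| λ ≤ |x(s; t₀, x, λξ)| ≤ 2a |s − t₀| λ and (1/(2a)) λ ≤ |ξ(s; t₀, x, λξ)| ≤ 2a λ. -/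
open MeasureTheory Complex Filter

noncomputable section

abbrev V (n : ℕ) := EuclideanSpace ℝ (Fin n)

/-- Japanese bracket power `⟨x⟩^s`. -/
def jap {n : ℕ} (x : V n) (s : ℝ) : ℝ := (1 + ‖x‖ ^ 2) ^ (s / 2)

/-- Assumption (A) on the magnetic vector potential. -/
def AssumptionA {n : ℕ} (a : ℝ → V n → V n) (ρ : ℝ) : Prop :=
  ContDiff ℝ (⊤ : ℕ∞) (fun p : ℝ × V n => a p.1 p.2) ∧
  ∀ k : ℕ, ∃ C : ℝ, 0 < C ∧ ∀ t : ℝ, ∀ x : V n,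
    ‖iteratedFDeriv ℝ k (a t) x‖ ≤ C * jap x (ρ - k)

/-- The Hamiltonian flow of `h(t,x,ξ) = |ξ - a(t,x)|²/2` with data `(x, ξ)` at time `t₀`. -/
def IsHamFlow {n : ℕ} (a : ℝ → V n → V n) (t₀ : ℝ) (x ξ : V n) (X Ξ : ℝ → V n) : Prop :=
  X t₀ = x ∧ Ξ t₀ = ξ ∧ ∀ s : ℝ,
    HasDerivAt X (Ξ s - a s (X s)) s ∧
    HasDerivAt Ξ (ContinuousLinearMap.adjoint (fderiv ℝ (a s) (X s)) (Ξ s - a s (X s))) s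

/-- Conic neighborhood of `ξ₀`. -/
def IsConicNbhd {n : ℕ} (Γ : Set (V n)) (ξ₀ : V n) : Prop :=
  IsOpen Γ ∧ ξ₀ ∈ Γ ∧ ∀ ξ ∈ Γ, ∀ c : ℝ, 0 < c → c • ξ ∈ Γ

/-- Continuity argument: a continuous `f` that stays strictly below `c` at `s` as soon as it does so
on `[0, s)` stays strictly below `c`. -/
theorem lt_of_bootstrap {f : ℝ → ℝ} (hf : Continuous f) {c T : ℝ}
    (h : ∀ s ∈ Set.Icc 0 T, (∀ τ ∈ Set.Ico 0 s, f τ < c) → f s < c) :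
    ∀ s ∈ Set.Icc 0 T, f s < c := by
  by_contra! hcon
  obtain ⟨s₁, hs₁, hs₁c⟩ := hcon
  have hcomp : IsCompact (Set.Icc 0 T ∩ {τ | c ≤ f τ}) :=
    isCompact_Icc.inter_right (isClosed_le continuous_const hf)
  obtain ⟨s, ⟨hs, hsc⟩, hmin⟩ := hcomp.exists_isLeast ⟨s₁, hs₁, hs₁c⟩
  refine absurd (h s hs fun τ hτ => ?_) (not_lt.2 hsc)
  by_contra! hcτ
  exact absurd (hmin ⟨⟨hτ.1, hτ.2.le.trans hs.2⟩, hcτ⟩) (not_le.2 hτ.2)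

/-- The mean value inequality on a segment, for functions differentiable on the line. -/
theorem norm_sub_le_of_norm_deriv_le_Ico {E : Type*} [NormedAddCommGroup E] [NormedSpace ℝ E]
    {f f' : ℝ → E} (hf : ∀ τ, HasDerivAt f (f' τ) τ) {u v C : ℝ} (huv : u ≤ v)
    (hC : ∀ τ ∈ Set.Ico u v, ‖f' τ‖ ≤ C) : ‖f v - f u‖ ≤ C * (v - u) :=
  norm_image_sub_le_of_norm_deriv_right_le_segment
    (fun τ _ => (hf τ).continuousAt.continuousWithinAt)
    (fun τ _ => (hf τ).hasDerivWithinAt) hC v ⟨huv, le_rfl⟩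

theorem norm_sub_affine_le {E : Type*} [NormedAddCommGroup E] [NormedSpace ℝ E]
    {σ : ℝ} (hσ : |σ| = 1) {Y w : ℝ → E} {ζ : E} {c τ : ℝ} (hτ : 0 ≤ τ)
    (hY : ∀ τ, HasDerivAt Y (σ • w τ) τ) (hw : ∀ r ∈ Set.Ico 0 τ, ‖w r - ζ‖ ≤ c) :
    ‖Y τ - Y 0 - τ • σ • ζ‖ ≤ c * τ := by
  have hd : ∀ r, HasDerivAt (fun r => Y r - r • σ • ζ) (σ • (w r - ζ)) r := fun r => by
    have := (hY r).sub ((hasDerivAt_id r).smul_const (σ • ζ))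
    rw [one_smul, ← smul_sub] at this
    exact this
  have := norm_sub_le_of_norm_deriv_le_Ico hd hτ (C := c) fun r hr => by
    rw [norm_smul, Real.norm_eq_abs, hσ, one_mul]
    exact hw r hr
  simp only [zero_smul, sub_zero] at this
  rwa [sub_right_comm] at this

theorem norm_le_of_norm_sub_affine_le {E : Type*} [NormedAddCommGroup E] [NormedSpace ℝ E]
    {σ : ℝ} (hσ : |σ| = 1) {y y₀ ζ : E} {c τ R m N : ℝ} (hτ : 0 ≤ τ)
    (hy₀ : ‖y₀‖ ≤ R) (hm : m ≤ ‖ζ‖) (hN : ‖ζ‖ ≤ N) (h : ‖y - y₀ - τ • σ • ζ‖ ≤ c * τ) :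
    (m - c) * τ - R ≤ ‖y‖ ∧ ‖y‖ ≤ R + (N + c) * τ := by
  have hz : ‖τ • σ • ζ‖ = τ * ‖ζ‖ := by
    rw [norm_smul, norm_smul, Real.norm_eq_abs, Real.norm_eq_abs, hσ, abs_of_nonneg hτ, one_mul]
  have h1 : y = (y - y₀ - τ • σ • ζ) + y₀ + τ • σ • ζ := by abel
  have h2 : τ • σ • ζ = y - y₀ - (y - y₀ - τ • σ • ζ) := by abel
  have h3 : ‖y‖ ≤ ‖y - y₀ - τ • σ • ζ‖ + ‖y₀‖ + ‖τ • σ • ζ‖ := by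
    conv_lhs => rw [h1]
    exact norm_add₃_le
  have h4 : ‖τ • σ • ζ‖ ≤ ‖y‖ + ‖y₀‖ + ‖y - y₀ - τ • σ • ζ‖ := by
    conv_lhs => rw [h2]
    exact (norm_sub_le _ _).trans (add_le_add_left (norm_sub_le _ _) _)
  have h5 := mul_le_mul_of_nonneg_left hm hτ
  have h6 := mul_le_mul_of_nonneg_left hN hτ
  constructor <;> nlinarith

/-- A trajectory of `Y' = ±(P - g)`, `P' = ±Q` starting with a large momentum `ζ`, along which `g` is
sublinear in `Y`, and `Q` is controlled by `P - g` with a factor that is small where `Y` is large,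
keeps a momentum close to `ζ`. -/
theorem momentum_near_initial {E : Type*} [NormedAddCommGroup E] [NormedSpace ℝ E]
    {σ : ℝ} (hσ : |σ| = 1) {Y P g Q : ℝ → E} {ζ : E} {T R m N ε D B M δ : ℝ}
    (hY : ∀ τ, HasDerivAt Y (σ • (P τ - g τ)) τ) (hP : ∀ τ, HasDerivAt P (σ • Q τ) τ)
    (hg : Continuous g) (hY0 : ‖Y 0‖ ≤ R) (hP0 : P 0 = ζ)
    (hm0 : 0 < m) (hm : m ≤ ‖ζ‖) (hN : ‖ζ‖ ≤ N) (hε : 0 ≤ ε) (hB : 0 ≤ B) (hδ : 0 ≤ δ)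
    (hgb : ∀ τ, ‖g τ‖ ≤ ε * ‖Y τ‖ + D)
    (hQB : ∀ τ, ‖Q τ‖ ≤ B * ‖P τ - g τ‖)
    (hQM : ∀ τ, M ≤ ‖Y τ‖ → ‖Q τ‖ ≤ ε * ‖P τ - g τ‖)
    (hsmall_g : ε * (R + 2 * N * T) + D ≤ m / 16)
    (hsmall_near : B * (2 * N) * δ ≤ m / 16)
    (hsmall_far : ε * (2 * N) * T ≤ m / 16)
    (hfar : M ≤ (3 / 4 * m) * δ - R) {s : ℝ} (hs : s ∈ Set.Icc 0 T) :
    ‖P s - ζ‖ ≤ m / 4 ∧ ‖Y s - Y 0 - s • σ • ζ‖ ≤ m / 4 * s := by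
  have hPc : Continuous P := continuous_iff_continuousAt.2 fun τ => (hP τ).continuousAt
  have hN0 : m ≤ N := hm.trans hN
  have key : ∀ s ∈ Set.Icc 0 T, (∀ τ ∈ Set.Ico 0 s, ‖P τ - g τ - ζ‖ < m / 4) →
      ‖P s - ζ‖ ≤ m / 8 ∧ ‖P s - g s - ζ‖ < m / 4 := by
    intro s hs hlt
    have hYτ : ∀ τ ∈ Set.Icc 0 s, (m - m / 4) * τ - R ≤ ‖Y τ‖ ∧ ‖Y τ‖ ≤ R + (N + m / 4) * τ :=
      fun τ hτ => norm_le_of_norm_sub_affine_le hσ hτ.1 hY0 hm hN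
        (norm_sub_affine_le hσ hτ.1 hY fun r hr => (hlt r ⟨hr.1, hr.2.trans_le hτ.2⟩).le)
    have hv : ∀ τ ∈ Set.Ico 0 s, ‖P τ - g τ‖ ≤ 2 * N := fun τ hτ => by
      have h1 := norm_le_norm_add_norm_sub' (P τ - g τ) ζ
      have h2 := hlt τ hτ
      linarith
    have hgs : ‖g s‖ ≤ m / 16 := by
      have h1 := (hYτ s ⟨hs.1, le_rfl⟩).2
      have h2 : (N + m / 4) * s ≤ 2 * N * T :=
        mul_le_mul (by linarith) hs.2 hs.1 (by linarith)
      have h3 : ε * ‖Y s‖ ≤ ε * (R + 2 * N * T) :=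
        mul_le_mul_of_nonneg_left (by linarith) hε
      linarith [hgb s]
    have hnear : ∀ r ∈ Set.Icc 0 s, r ≤ δ → ‖P r - ζ‖ ≤ m / 16 := fun r hr hrδ => by
      have h1 := norm_sub_le_of_norm_deriv_le_Ico hP hr.1 (C := B * (2 * N)) fun τ hτ => by
        rw [norm_smul, Real.norm_eq_abs, hσ, one_mul]
        exact (hQB τ).trans
          (mul_le_mul_of_nonneg_left (hv τ ⟨hτ.1, hτ.2.trans_le hr.2⟩) hB)
      rw [hP0, sub_zero] at h1
      have h2 : B * (2 * N) * r ≤ B * (2 * N) * δ :=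
        mul_le_mul_of_nonneg_left hrδ (mul_nonneg hB (by linarith))
      linarith
    have hPs : ‖P s - ζ‖ ≤ m / 8 := by
      rcases le_total s δ with hsδ | hsδ
      · linarith [hnear s ⟨hs.1, le_rfl⟩ hsδ]
      · have h0 := hnear δ ⟨hδ, hsδ⟩ le_rfl
        have h1 := norm_sub_le_of_norm_deriv_le_Ico hP hsδ (C := ε * (2 * N)) fun τ hτ => by
          have hτ0 : 0 ≤ τ := hδ.trans hτ.1
          rw [norm_smul, Real.norm_eq_abs, hσ, one_mul]
          refine (hQM τ ?_).trans (mul_le_mul_of_nonneg_left (hv τ ⟨hτ0, hτ.2⟩) hε)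
          have h2 := (hYτ τ ⟨hτ0, hτ.2.le⟩).1
          have h3 : (3 / 4 * m) * δ ≤ (3 / 4 * m) * τ :=
            mul_le_mul_of_nonneg_left hτ.1 (by linarith)
          linarith
        have h2 : ε * (2 * N) * (s - δ) ≤ ε * (2 * N) * T :=
          mul_le_mul_of_nonneg_left (by linarith [hs.2]) (mul_nonneg hε (by linarith))
        have h3 := norm_sub_le_norm_sub_add_norm_sub (P s) (P δ) ζ
        linarith
    refine ⟨hPs, ?_⟩
    have h1 : ‖P s - g s - ζ‖ ≤ ‖P s - ζ‖ + ‖g s‖ := by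
      rw [sub_right_comm]
      exact norm_sub_le _ _
    linarith
  have hall := lt_of_bootstrap (f := fun τ => ‖P τ - g τ - ζ‖) (by fun_prop)
    fun s hs h => (key s hs h).2
  refine ⟨?_, norm_sub_affine_le hσ hs.1 hY fun r hr =>
    (hall r ⟨hr.1, hr.2.le.trans hs.2⟩).le⟩
  have := (key s hs fun τ hτ => hall τ ⟨hτ.1, hτ.2.le.trans hs.2⟩).1
  linarith

theorem jap_le_one {n : ℕ} (x : V n) {r : ℝ} (hr : r ≤ 0) : jap x r ≤ 1 :=
  Real.rpow_le_one_of_one_le_of_nonpos (by nlinarith [sq_nonneg ‖x‖]) (by linarith)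

theorem jap_nonneg {n : ℕ} (x : V n) (r : ℝ) : 0 ≤ jap x r :=
  Real.rpow_nonneg (by positivity) _

theorem jap_le_jap_sub_one_mul {n : ℕ} (x : V n) (r : ℝ) :
    jap x r ≤ jap x (r - 1) * (1 + ‖x‖) := by
  have h0 : (0 : ℝ) < 1 + ‖x‖ ^ 2 := by positivity
  have h1 : jap x r = jap x (r - 1) * √(1 + ‖x‖ ^ 2) := by
    rw [jap, jap, Real.sqrt_eq_rpow, ← Real.rpow_add h0]
    congr 1
    ring
  rw [h1]
  refine mul_le_mul_of_nonneg_left (Real.sqrt_le_iff.2 ⟨by positivity, ?_⟩) (jap_nonneg _ _)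
  nlinarith [norm_nonneg x]

theorem exists_mul_jap_le {n : ℕ} (C : ℝ) {r : ℝ} (hr : r < 0) {ε : ℝ} (hε : 0 < ε) :
    ∃ M : ℝ, ∀ x : V n, M ≤ ‖x‖ → C * jap x r ≤ ε := by
  have h1 : Tendsto (fun y : ℝ => 1 + y ^ 2) atTop atTop :=
    tendsto_atTop_add_const_left _ _ (tendsto_pow_atTop two_ne_zero)
  have h2 := ((tendsto_rpow_neg_atTop (y := -(r / 2)) (by linarith)).comp h1).const_mul C
  rw [mul_zero] at h2
  obtain ⟨M, hM⟩ := eventually_atTop.1 (h2.eventually_le_const hε)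
  refine ⟨M, fun x hx => ?_⟩
  simpa [jap] using hM _ hx

/-- Under Assumption (A), the potential is sublinear and its derivative is bounded and decays. -/
theorem AssumptionA.exists_bounds {n : ℕ} {a : ℝ → V n → V n} {ρ : ℝ} (hA : AssumptionA a ρ)
    (hρ : ρ < 1) : ∃ B : ℝ, 0 < B ∧ (∀ t x, ‖fderiv ℝ (a t) x‖ ≤ B) ∧
      ∀ ε : ℝ, 0 < ε → ∃ M D : ℝ, (∀ t x, M ≤ ‖x‖ → ‖fderiv ℝ (a t) x‖ ≤ ε) ∧
        ∀ t x, ‖a t x‖ ≤ ε * ‖x‖ + D := by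
  obtain ⟨C₀, hC₀, h₀⟩ := hA.2 0
  obtain ⟨C₁, hC₁, h₁⟩ := hA.2 1
  simp only [norm_iteratedFDeriv_zero, Nat.cast_zero, sub_zero] at h₀
  simp only [norm_iteratedFDeriv_one, Nat.cast_one] at h₁
  refine ⟨C₁, hC₁, fun t x => (h₁ t x).trans
    (mul_le_of_le_one_right hC₁.le (jap_le_one x (by linarith))), fun ε hε => ?_⟩
  obtain ⟨M₀, hM₀⟩ := exists_mul_jap_le (n := n) C₀ (sub_neg.2 hρ) hε
  obtain ⟨M₁, hM₁⟩ := exists_mul_jap_le (n := n) C₁ (sub_neg.2 hρ) hε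
  refine ⟨M₁, ε + C₀ * (1 + |M₀|), fun t x hx => (h₁ t x).trans (hM₁ x hx), fun t x => ?_⟩
  have hx0 := norm_nonneg x
  have h2 : ‖a t x‖ ≤ C₀ * jap x (ρ - 1) * (1 + ‖x‖) := by
    rw [mul_assoc]
    exact (h₀ t x).trans (mul_le_mul_of_nonneg_left (jap_le_jap_sub_one_mul x ρ) hC₀.le)
  rcases le_total M₀ ‖x‖ with hx | hx
  · have h3 := mul_le_mul_of_nonneg_right (hM₀ x hx) (by linarith : 0 ≤ 1 + ‖x‖)
    have h4 : 0 ≤ C₀ * (1 + |M₀|) := by positivity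
    linarith
  · have h3 : C₀ * jap x (ρ - 1) * (1 + ‖x‖) ≤ C₀ * (1 + |M₀|) :=
      mul_le_mul (mul_le_of_le_one_right hC₀.le (jap_le_one x (by linarith)))
        (by linarith [le_abs_self M₀]) (by linarith) hC₀.le
    nlinarith

/-- **Lemma A.1.** For `λ^{p-1} ≤ |s - t₀| ≤ t₀` and `λ` large, the Hamiltonian
trajectory satisfies `(2a)⁻¹ λ|s-t₀| ≤ |x(s)| ≤ 2a λ|s-t₀|` and
`(2a)⁻¹ λ ≤ |ξ(s)| ≤ 2a λ`. -/
theorem trajectory_bounds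
    (n : ℕ) (hn : 2 ≤ n) (a : ℝ → V n → V n) (ρ : ℝ) (hρ : ρ < 1)
    (hA : AssumptionA a ρ)
    (p : ℝ) (hp0 : 0 < p) (hp1 : p < 1) (A : ℝ) (hA1 : 1 ≤ A)
    (t₀ : ℝ) (ht₀ : 0 < t₀) (x₀ ξ₀ : V n)
    (K : Set (V n)) (hK : K ∈ nhds x₀) (hKc : IsCompact (closure K))
    (Γ : Set (V n)) (hΓ : IsConicNbhd Γ ξ₀) :
    ∃ lam₀ : ℝ, 0 < lam₀ ∧ ∀ lam : ℝ, lam₀ ≤ lam →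
      ∀ s : ℝ, lam ^ (p - 1) ≤ |s - t₀| → |s - t₀| ≤ t₀ →
      ∀ x ∈ K, ∀ ξ ∈ Γ, A⁻¹ ≤ ‖ξ‖ → ‖ξ‖ ≤ A →
      ∀ X Ξ : ℝ → V n, IsHamFlow a t₀ x (lam • ξ) X Ξ →
        ((2 * A)⁻¹ * |s - t₀| * lam ≤ ‖X s‖ ∧ ‖X s‖ ≤ 2 * A * |s - t₀| * lam) ∧
        ((2 * A)⁻¹ * lam ≤ ‖Ξ s‖ ∧ ‖Ξ s‖ ≤ 2 * A * lam) := by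
  obtain ⟨R₀, hR₀⟩ := hKc.isBounded.exists_norm_le
  set R := |R₀|
  have hR : ∀ x ∈ K, ‖x‖ ≤ R := fun x hx => (hR₀ x (subset_closure hx)).trans (le_abs_self _)
  have hR0 : 0 ≤ R := abs_nonneg _
  have hA0 : 0 < A := by linarith
  obtain ⟨B, hB0, hB, hbd⟩ := hA.exists_bounds hρ
  set ε := (64 * A ^ 2 * t₀)⁻¹ with hε
  have hε0 : 0 < ε := by positivity
  have hεe : ε * A * t₀ = A⁻¹ / 64 := by
    rw [hε]
    field_simp
  obtain ⟨M, D, hM, hD⟩ := hbd ε hε0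
  set δ := (32 * A ^ 2 * B)⁻¹ with hδ
  have hδ0 : 0 < δ := by positivity
  have hδe : B * A * δ = A⁻¹ / 32 := by
    rw [hδ]
    field_simp
  have hAi : 0 < A⁻¹ := inv_pos.2 hA0
  have hAiA : A⁻¹ ≤ A := (inv_le_one_of_one_le₀ hA1).trans hA1
  have hev : ∀ᶠ lam : ℝ in atTop, 0 < lam ∧ ε * R + D ≤ A⁻¹ / 32 * lam ∧
      M + R ≤ 3 / 4 * A⁻¹ * δ * lam ∧ 4 * A * R ≤ lam ^ p :=
    (eventually_gt_atTop 0).and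
      (((tendsto_id.const_mul_atTop (by positivity)).eventually_ge_atTop _).and
        (((tendsto_id.const_mul_atTop (by positivity)).eventually_ge_atTop _).and
          ((tendsto_rpow_atTop hp0).eventually_ge_atTop _)))
  obtain ⟨l, hl⟩ := eventually_atTop.1 hev
  refine ⟨max l 1, by positivity, fun lam hlam s hs1 hs2 x hx ξ _ hξ1 hξ2 X Ξ hflow => ?_⟩
  obtain ⟨hlam0, hlD, hlM, hlp⟩ := hl lam ((le_max_left _ _).trans hlam)
  obtain ⟨hX0, hΞ0, hd⟩ := hflow
  obtain ⟨σ, hσ, hσs⟩ : ∃ σ : ℝ, |σ| = 1 ∧ t₀ + σ * |s - t₀| = s := by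
    rcases le_total t₀ s with h | h
    · exact ⟨1, by simp, by rw [abs_of_nonneg (by linarith)]; ring⟩
    · exact ⟨-1, by simp, by rw [abs_of_nonpos (by linarith)]; ring⟩
  have hnorm : ‖lam • ξ‖ = ‖ξ‖ * lam := by
    rw [norm_smul, Real.norm_eq_abs, abs_of_pos hlam0, mul_comm]
  have hm : A⁻¹ * lam ≤ ‖lam • ξ‖ := hnorm ▸ mul_le_mul_of_nonneg_right hξ1 hlam0.le
  have hN : ‖lam • ξ‖ ≤ A * lam := hnorm ▸ mul_le_mul_of_nonneg_right hξ2 hlam0.le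
  have hline : ∀ τ, HasDerivAt (fun τ : ℝ => t₀ + σ * τ) σ τ := fun τ => by
    simpa using ((hasDerivAt_id τ).const_mul σ).const_add t₀
  have hXc : Continuous X := continuous_iff_continuousAt.2 fun τ => (hd τ).1.continuousAt
  have hac : Continuous fun q : ℝ × V n => a q.1 q.2 := hA.1.continuous
  have hQ : ∀ r c, ‖fderiv ℝ (a r) (X r)‖ ≤ c →
      ‖ContinuousLinearMap.adjoint (fderiv ℝ (a r) (X r)) (Ξ r - a r (X r))‖ ≤
        c * ‖Ξ r - a r (X r)‖ := fun r c hc =>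
    ContinuousLinearMap.le_of_opNorm_le _ (by rwa [LinearIsometryEquiv.norm_map]) _
  obtain ⟨hP, hY⟩ := momentum_near_initial (T := t₀) (R := R) (m := A⁻¹ * lam) (N := A * lam)
    (Y := fun τ => X (t₀ + σ * τ)) (P := fun τ => Ξ (t₀ + σ * τ))
    (g := fun τ => a (t₀ + σ * τ) (X (t₀ + σ * τ)))
    (Q := fun τ => ContinuousLinearMap.adjoint (fderiv ℝ (a (t₀ + σ * τ)) (X (t₀ + σ * τ)))
      (Ξ (t₀ + σ * τ) - a (t₀ + σ * τ) (X (t₀ + σ * τ))))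
    (ζ := lam • ξ) (ε := ε) (D := D) (B := B) (M := M) (δ := δ) hσ
    (fun τ => (hd _).1.scomp τ (hline τ)) (fun τ => (hd _).2.scomp τ (hline τ))
    (hac.comp (by fun_prop : Continuous fun τ : ℝ => (t₀ + σ * τ, X (t₀ + σ * τ))))
    (by simpa [hX0] using hR x hx) (by simpa using hΞ0) (by positivity) hm hN
    hε0.le hB0.le hδ0.le (fun τ => hD _ _) (fun τ => hQ _ _ (hB _ _))
    (fun τ hτ => hQ _ _ (hM _ _ hτ))
    (by linear_combination hlD + 2 * lam * hεe)
    (by linear_combination 2 * lam * hδe)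
    (by nlinarith [mul_pos hAi hlam0])
    (by linear_combination hlM) ⟨abs_nonneg (s - t₀), hs2⟩
  have hYb := norm_le_of_norm_sub_affine_le hσ (abs_nonneg (s - t₀))
    (by simpa [hX0] using hR x hx) hm hN hY
  simp only [hσs] at hP hYb
  have hdist : 4 * A * R ≤ |s - t₀| * lam := by
    refine hlp.trans ?_
    have h1 := mul_le_mul_of_nonneg_right hs1 hlam0.le
    rwa [← Real.rpow_add_one hlam0.ne', sub_add_cancel] at h1
  have hR4 : R ≤ A⁻¹ / 4 * (|s - t₀| * lam) := by
    have h1 := mul_le_mul_of_nonneg_left hdist (by positivity : 0 ≤ A⁻¹ / 4)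
    have h2 : A⁻¹ / 4 * (4 * A * R) = R := by field_simp
    linarith
  have h2A : (2 * A)⁻¹ = A⁻¹ / 2 := by
    rw [mul_inv]
    ring
  have hz := mul_le_mul_of_nonneg_right hAiA hlam0.le
  have hzs := mul_le_mul_of_nonneg_right hAiA (mul_nonneg (abs_nonneg (s - t₀)) hlam0.le)
  have hzs0 := mul_nonneg hAi.le (mul_nonneg (abs_nonneg (s - t₀)) hlam0.le)
  have hz0 := mul_pos hAi hlam0
  rw [h2A]
  refine ⟨⟨by linarith [hYb.1], by linarith [hYb.2]⟩, ?_, ?_⟩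
  · linarith [norm_le_norm_add_norm_sub (Ξ s) (lam • ξ)]
  · linarith [norm_le_norm_add_norm_sub' (Ξ s) (lam • ξ)]

end
end

section
/- Let n ≥ 2, let a(t,x) satisfy Assumption (A), set b = min(1/8, (1−ρ)/8) and ε = (1−ρ)/2. Fix t₀ > 0, a ≥ 1, a bounded neighborhood K of x₀ and a conic neighborhood Γ of ξ₀. Then for all multi-indices α, β, γ with |α| ≥ 2 and β + γ = α, there exist a constant C > 0 and λ₀ ≥ 1 such that sup_{s∈[0,t₀]} ( ⟨x(s;t₀,x,λξ)⟩^{1+ε+ρ−|α|} |s−t₀|^{|β|} ) · λ^{b(|β|−|γ|)} ≤ C λ^{−2b} for all λ ≥ λ₀, x ∈ K and ξ ∈ Γ_a. -/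
open MeasureTheory Complex Filter

noncomputable section

def msize {n : ℕ} (α : Fin n → ℕ) : ℕ := ∑ j, α j

/-- A continuity (bootstrap) argument: a continuous function which is negative at `T` as soon as it
is nonpositive on `[0, T)` is nonpositive on the whole interval. -/
theorem nonpos_of_bootstrap {f : ℝ → ℝ} (hf : Continuous f) {t : ℝ}
    (h : ∀ T, 0 ≤ T → T ≤ t → (∀ τ, 0 ≤ τ → τ < T → f τ ≤ 0) → f T < 0) :
    ∀ τ, 0 ≤ τ → τ ≤ t → f τ ≤ 0 := by
  intro τ₁ h0 h1
  by_contra! hpos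
  have hcomp : IsCompact (Set.Icc 0 τ₁ ∩ {τ | 0 ≤ f τ}) :=
    isCompact_Icc.inter_right (isClosed_le continuous_const hf)
  obtain ⟨T, ⟨hT, hfT⟩, hmin⟩ :=
    hcomp.exists_isLeast ⟨τ₁, ⟨h0, le_rfl⟩, hpos.le⟩
  refine absurd (h T hT.1 (hT.2.trans h1) fun τ hτ0 hτT => ?_) (not_lt.2 hfT)
  by_contra! hτ
  exact absurd (hmin ⟨⟨hτ0, hτT.le.trans hT.2⟩, hτ.le⟩) (not_le.2 hτT)

theorem eventually_mul_rpow_lt {C u T c e : ℝ} (hC : 0 ≤ C) (hu : 0 ≤ u) (hT : 0 ≤ T)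
    (hc : 0 < c) (he0 : 0 ≤ e) (he : e < 1) :
    ∀ᶠ lam : ℝ in atTop, C * (u + T * lam) ^ e < c * lam := by
  have h1 : Tendsto (fun l : ℝ => l ^ (1 - e)) atTop atTop := tendsto_rpow_atTop (by linarith)
  filter_upwards [h1.eventually_gt_atTop (C * (u + T) ^ e / c), eventually_ge_atTop 1]
    with l hl hl1
  have hl0 : 0 < l := by linarith
  rw [div_lt_iff₀ hc] at hl
  have hle : u + T * l ≤ (u + T) * l := by nlinarith
  calc C * (u + T * l) ^ e ≤ C * ((u + T) * l) ^ e := by gcongr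
    _ = (C * (u + T) ^ e) * l ^ e := by
        rw [Real.mul_rpow (by positivity) hl0.le]; ring
    _ < (l ^ (1 - e) * c) * l ^ e := by gcongr
    _ = c * l := by
        rw [mul_right_comm, ← Real.rpow_add hl0, sub_add_cancel, Real.rpow_one, mul_comm]

theorem jap_eq_sqrt_rpow {n : ℕ} (x : V n) (s : ℝ) : jap x s = √(1 + ‖x‖ ^ 2) ^ s := by
  rw [jap, Real.sqrt_eq_rpow, ← Real.rpow_mul (by positivity)]
  congr 1
  ring

theorem one_le_sqrt_one_add_sq (r : ℝ) : 1 ≤ √(1 + r ^ 2) :=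
  Real.one_le_sqrt.2 (by nlinarith [sq_nonneg r])

theorem le_sqrt_one_add_sq (r : ℝ) : r ≤ √(1 + r ^ 2) :=
  Real.le_sqrt_of_sq_le (by linarith)

theorem sqrt_one_add_sq_le {r : ℝ} (hr : 0 ≤ r) : √(1 + r ^ 2) ≤ 1 + r :=
  Real.sqrt_le_iff.2 ⟨by linarith, by nlinarith⟩

theorem norm_sub_le_of_hasDerivAt_of_lt {E : Type*} [NormedAddCommGroup E] [NormedSpace ℝ E]
    {f f' : ℝ → E} {B B' : ℝ → ℝ} {T : ℝ} (hT : 0 ≤ T)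
    (hf : ∀ τ, HasDerivAt f (f' τ) τ) (hB0 : 0 ≤ B 0)
    (hB : ∀ τ, 0 ≤ τ → HasDerivAt B (B' τ) τ)
    (hle : ∀ τ, 0 ≤ τ → τ < T → ‖f' τ‖ ≤ B' τ) : ‖f T - f 0‖ ≤ B T := by
  refine image_norm_le_of_norm_deriv_right_le_deriv_boundary' (f := fun τ => f τ - f 0)
    (f' := f') (B := B) (B' := B') (a := 0) (b := T) ?_ ?_ ?_ ?_ ?_ ?_ ⟨hT, le_rfl⟩
  · exact fun τ _ => ((hf τ).sub_const _).continuousAt.continuousWithinAt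
  · exact fun τ _ => ((hf τ).sub_const _).hasDerivWithinAt
  · simpa using hB0
  · exact fun τ hτ => (hB τ hτ.1).continuousAt.continuousWithinAt
  · exact fun τ hτ => (hB τ hτ.1).hasDerivWithinAt
  · exact fun τ hτ => hle τ hτ.1 hτ.2

/-- A trajectory starting near the origin with large momentum `η` of size `lam`, subject to
a drift `g` of sublinear growth and a force `Q` decaying in space, leaves at speed at least
comparable to `lam`. -/
theorem mul_le_sqrt_of_escaping {E : Type*} [NormedAddCommGroup E] [NormedSpace ℝ E]
    {Y P g Q : ℝ → E} {x η : E} {C₀ C₁ R A t lam e c D : ℝ}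
    (hC₀ : 0 ≤ C₀) (hC₁ : 0 ≤ C₁) (hR : 0 ≤ R) (hA : 0 < A) (hlam : 1 ≤ lam)
    (he0 : 0 < e) (he1 : e < 1) (hc : c = 1 / (4 * A)) (hD : D = 1 + 2 * A * (1 + R))
    (hY : ∀ τ, HasDerivAt Y (-(P τ - g τ)) τ) (hP : ∀ τ, HasDerivAt P (Q τ) τ)
    (hg : ∀ τ, ‖g τ‖ ≤ C₀ * √(1 + ‖Y τ‖ ^ 2) ^ e)
    (hQ : ∀ τ, ‖Q τ‖ ≤ C₁ * √(1 + ‖Y τ‖ ^ 2) ^ (e - 1) * ‖P τ - g τ‖)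
    (hY0 : Y 0 = x) (hP0 : P 0 = η) (hx : ‖x‖ ≤ R)
    (hη : A⁻¹ * lam ≤ ‖η‖) (hη' : ‖η‖ ≤ A * lam)
    (h1 : C₀ * (1 + R + (A * t + 2 * c * t + 1) * lam) ^ e < c * lam)
    (h2 : C₁ * (A + 2 * c) * D ^ (1 - e) / e * (1 + t * lam) ^ e < c * lam) :
    ∀ τ, 0 ≤ τ → τ ≤ t → lam * τ ≤ D * √(1 + ‖Y τ‖ ^ 2) := by
  have hl0 : 0 < lam := by linarith
  have hc0 : 0 < c := by rw [hc]; positivity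
  have hD0 : 0 < D := by rw [hD]; positivity
  have hcA : A⁻¹ = 4 * c := by rw [hc]; field_simp
  have hAc : A * c = 1 / 4 := by rw [hc]; field_simp
  have drift : ∀ τ, 0 ≤ τ → τ ≤ t → ‖Y τ - x + τ • η‖ ≤ lam * (2 * c * t + 1) →
      ‖g τ‖ ≤ c * lam := by
    intro τ h0 ht hb
    have hYτ : ‖Y τ‖ ≤ R + (A * t + 2 * c * t + 1) * lam := by
      have : Y τ = x - τ • η + (Y τ - x + τ • η) := by abel
      have h3 : ‖τ • η‖ ≤ t * (A * lam) := by
        rw [norm_smul, Real.norm_of_nonneg h0]; gcongr; linarith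
      have h4 := norm_add_le (x - τ • η) (Y τ - x + τ • η)
      have h5 := norm_sub_le x (τ • η)
      rw [← this] at h4
      linarith
    refine (hg τ).trans (le_trans ?_ h1.le)
    gcongr
    exact (sqrt_one_add_sq_le (norm_nonneg _)).trans (by linarith)
  have hYd : ∀ τ, HasDerivAt (fun τ => Y τ + τ • η) (-(P τ - g τ) + (1 : ℝ) • η) τ :=
    fun τ => (hY τ).add ((hasDerivAt_id τ).smul_const η)
  have position : ∀ T, 0 ≤ T → T ≤ t →
      (∀ τ, 0 ≤ τ → τ < T → ‖P τ - η‖ ≤ c * lam ∧ ‖Y τ - x + τ • η‖ ≤ lam * (2 * c * t + 1)) →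
      ‖Y T - x + T • η‖ ≤ 2 * c * lam * T := by
    intro T hT hTt hb
    have := norm_sub_le_of_hasDerivAt_of_lt (B := fun τ => 2 * c * lam * τ)
      (B' := fun _ => 2 * c * lam) hT hYd (by simp)
      (fun τ _ => by simpa using (hasDerivAt_id τ).const_mul (2 * c * lam)) (by
        intro τ h0 hτ
        have h3 := drift τ h0 (by linarith) (hb τ h0 hτ).2
        have h4 := (hb τ h0 hτ).1
        have : -(P τ - g τ) + (1 : ℝ) • η = g τ - (P τ - η) := by rw [one_smul]; abel
        rw [this]
        linarith [norm_sub_le (g τ) (P τ - η)])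
    simp only [zero_smul, add_zero, hY0] at this
    rwa [show Y T - x + T • η = Y T + T • η - x by abel]
  have escape : ∀ τ, 0 ≤ τ → ‖Y τ - x + τ • η‖ ≤ 2 * c * lam * τ →
      1 + lam * τ ≤ D * √(1 + ‖Y τ‖ ^ 2) := by
    intro τ h0 hb
    have h3 : τ * (4 * c * lam) ≤ ‖τ • η‖ := by
      rw [norm_smul, Real.norm_of_nonneg h0, ← hcA]; gcongr
    have h4 : ‖τ • η‖ ≤ ‖Y τ - x + τ • η‖ + ‖Y τ‖ + ‖x‖ := by
      have h5 := norm_sub_le (Y τ - x + τ • η) (Y τ - x)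
      rw [add_sub_cancel_left] at h5
      linarith [norm_sub_le (Y τ) x]
    have h5 : 2 * c * (lam * τ) ≤ ‖Y τ‖ + R := by nlinarith
    have h6 : lam * τ ≤ 2 * A * (‖Y τ‖ + R) := by
      have := mul_le_mul_of_nonneg_left h5 (by positivity : 0 ≤ 2 * A)
      calc lam * τ = 2 * A * (2 * c * (lam * τ)) := by
            linear_combination (-4 * lam * τ) * hAc
        _ ≤ _ := this
    have h7 := one_le_sqrt_one_add_sq ‖Y τ‖
    have h8 := le_sqrt_one_add_sq ‖Y τ‖
    have h9 : ‖Y τ‖ + R ≤ (1 + R) * √(1 + ‖Y τ‖ ^ 2) := by nlinarith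
    rw [hD]
    nlinarith
  have hYc : Continuous Y := continuous_iff_continuousAt.2 fun τ => (hY τ).continuousAt
  have hPc : Continuous P := continuous_iff_continuousAt.2 fun τ => (hP τ).continuousAt
  have boot : ∀ τ, 0 ≤ τ → τ ≤ t →
      max (‖P τ - η‖ - c * lam) (‖Y τ - x + τ • η‖ - lam * (2 * c * t + 1)) ≤ 0 := by
    refine nonpos_of_bootstrap (by fun_prop) fun T hT hTt hb => ?_
    have hb' : ∀ τ, 0 ≤ τ → τ < T →
        ‖P τ - η‖ ≤ c * lam ∧ ‖Y τ - x + τ • η‖ ≤ lam * (2 * c * t + 1) := fun τ h0 hτ => by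
      have := max_le_iff.1 (hb τ h0 hτ)
      exact ⟨by linarith, by linarith⟩
    refine max_lt ?_ ?_
    · set C₃ := C₁ * (A + 2 * c) * D ^ (1 - e) with hC₃
      have hC₃0 : 0 ≤ C₃ := by positivity
      have := norm_sub_le_of_hasDerivAt_of_lt (B := fun τ => C₃ / e * (1 + τ * lam) ^ e)
        (B' := fun τ => C₃ * lam * (1 + τ * lam) ^ (e - 1)) hT hP (by positivity)
        (fun τ h0 => by
          have hd : HasDerivAt (fun τ : ℝ => 1 + τ * lam) lam τ := by
            simpa using ((hasDerivAt_id τ).mul_const lam).const_add 1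
          have hpos : 0 < 1 + τ * lam := by positivity
          have := (hd.rpow_const (p := e) (Or.inl hpos.ne')).const_mul (C₃ / e)
          rwa [show C₃ / e * (lam * e * (1 + τ * lam) ^ (e - 1)) =
            C₃ * lam * (1 + τ * lam) ^ (e - 1) by field_simp] at this) (by
          intro τ h0 hτ
          obtain ⟨hb1, hb2⟩ := hb' τ h0 hτ
          have h3 := drift τ h0 (by linarith) hb2
          have h4 := escape τ h0 (position τ h0 (by linarith)
            fun σ hσ hστ => hb' σ hσ (hστ.trans hτ))
          have h5 : ‖P τ - g τ‖ ≤ (A + 2 * c) * lam := by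
            have h6 := norm_sub_le (P τ - η + η) (g τ)
            rw [sub_add_cancel] at h6
            have h7 := norm_add_le (P τ - η) η
            rw [sub_add_cancel] at h7
            linarith
          have h8 : √(1 + ‖Y τ‖ ^ 2) ^ (e - 1) ≤ D ^ (1 - e) * (1 + τ * lam) ^ (e - 1) := by
            have hpos : 0 < 1 + τ * lam := by positivity
            have h9 : D⁻¹ * (1 + τ * lam) ≤ √(1 + ‖Y τ‖ ^ 2) := by
              rw [inv_mul_le_iff₀ hD0, mul_comm τ]; exact h4
            calc √(1 + ‖Y τ‖ ^ 2) ^ (e - 1) ≤ (D⁻¹ * (1 + τ * lam)) ^ (e - 1) :=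
                  Real.rpow_le_rpow_of_nonpos (by positivity) h9 (by linarith)
              _ = _ := by
                  rw [Real.mul_rpow (by positivity) hpos.le, Real.inv_rpow hD0.le,
                    ← Real.rpow_neg hD0.le, neg_sub]
          calc ‖Q τ‖ ≤ _ := hQ τ
            _ ≤ C₁ * (D ^ (1 - e) * (1 + τ * lam) ^ (e - 1)) * ((A + 2 * c) * lam) := by gcongr
            _ = C₃ * lam * (1 + τ * lam) ^ (e - 1) := by rw [hC₃]; ring)
      rw [hP0] at this
      have h3 : C₃ / e * (1 + T * lam) ^ e ≤ C₃ / e * (1 + t * lam) ^ e := by gcongr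
      linarith
    · have := position T hT hTt hb'
      have h3 : 2 * c * lam * T ≤ 2 * c * lam * t := by gcongr
      linarith
  intro τ h0 ht
  have := escape τ h0 (position τ h0 ht fun σ hσ hστ => by
    have := max_le_iff.1 (boot σ hσ (by linarith))
    exact ⟨by linarith, by linarith⟩)
  linarith

theorem AssumptionA.exists_norm_le {n : ℕ} {a : ℝ → V n → V n} {ρ e : ℝ} (hA : AssumptionA a ρ)
    (he : ρ ≤ e) : ∃ C : ℝ, 0 < C ∧ ∀ t x, ‖a t x‖ ≤ C * √(1 + ‖x‖ ^ 2) ^ e := by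
  obtain ⟨C, hC, h⟩ := hA.2 0
  refine ⟨C, hC, fun t x => ?_⟩
  have := h t x
  rw [norm_iteratedFDeriv_zero, jap_eq_sqrt_rpow] at this
  refine this.trans ?_
  gcongr
  · exact one_le_sqrt_one_add_sq _
  · simpa using he

theorem AssumptionA.exists_norm_fderiv_le {n : ℕ} {a : ℝ → V n → V n} {ρ e : ℝ}
    (hA : AssumptionA a ρ) (he : ρ ≤ e) :
    ∃ C : ℝ, 0 < C ∧ ∀ t x, ‖fderiv ℝ (a t) x‖ ≤ C * √(1 + ‖x‖ ^ 2) ^ (e - 1) := by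
  obtain ⟨C, hC, h⟩ := hA.2 1
  refine ⟨C, hC, fun t x => ?_⟩
  have := h t x
  rw [norm_iteratedFDeriv_one, jap_eq_sqrt_rpow] at this
  refine this.trans ?_
  gcongr
  · exact one_le_sqrt_one_add_sq _
  · simp

/-- The backward flow with initial momentum of size `lam` escapes at speed comparable to `lam`,
uniformly for bounded initial positions. -/
theorem AssumptionA.exists_flow_lower_bound {n : ℕ} {a : ℝ → V n → V n} {ρ : ℝ} (hρ : ρ < 1)
    (hA : AssumptionA a ρ) {t₀ : ℝ} (ht₀ : 0 < t₀) {A : ℝ} (hA1 : 1 ≤ A) {K : Set (V n)}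
    (hK : Bornology.IsBounded K) :
    ∃ D : ℝ, 0 < D ∧ ∃ lam₀ : ℝ, 1 ≤ lam₀ ∧ ∀ lam, lam₀ ≤ lam → ∀ x ∈ K, ∀ ξ : V n,
      A⁻¹ ≤ ‖ξ‖ → ‖ξ‖ ≤ A → ∀ X Ξ : ℝ → V n, IsHamFlow a t₀ x (lam • ξ) X Ξ →
      ∀ s, 0 ≤ s → s ≤ t₀ → lam * |s - t₀| ≤ D * √(1 + ‖X s‖ ^ 2) := by
  obtain ⟨R, hR, hKR⟩ : ∃ R : ℝ, 0 < R ∧ ∀ x ∈ K, ‖x‖ ≤ R := hK.exists_pos_norm_le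
  have hA0 : 0 < A := by linarith
  set e : ℝ := max ρ (1 / 2)
  have he0 : 0 < e := lt_max_of_lt_right (by norm_num)
  have he1 : e < 1 := max_lt hρ (by norm_num)
  obtain ⟨C₀, hC₀, h₀⟩ := hA.exists_norm_le (le_max_left ρ (1 / 2))
  obtain ⟨C₁, hC₁, h₁⟩ := hA.exists_norm_fderiv_le (le_max_left ρ (1 / 2))
  set c : ℝ := 1 / (4 * A) with hc
  have hc0 : 0 < c := by positivity
  set D : ℝ := 1 + 2 * A * (1 + R) with hD
  have hD0 : 0 < D := by positivity
  obtain ⟨l, hl⟩ := eventually_atTop.1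
    ((eventually_mul_rpow_lt (C := C₀) (u := 1 + R) (T := A * t₀ + 2 * c * t₀ + 1) hC₀.le
      (by positivity) (by positivity) hc0 he0.le he1).and
    (eventually_mul_rpow_lt (C := C₁ * (A + 2 * c) * D ^ (1 - e) / e) (u := 1) (T := t₀)
      (by positivity) (by positivity) ht₀.le hc0 he0.le he1))
  refine ⟨D, hD0, max l 1, le_max_right _ _, ?_⟩
  intro lam hlam x hx ξ hξ hξ' X Ξ hflow s hs0 hs
  obtain ⟨hX0, hΞ0, hd⟩ := hflow
  have hlam1 : 1 ≤ lam := (le_max_right _ _).trans hlam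
  obtain ⟨hl1, hl2⟩ := hl lam ((le_max_left _ _).trans hlam)
  have hnorm : ‖lam • ξ‖ = lam * ‖ξ‖ := by
    rw [norm_smul, Real.norm_of_nonneg (by linarith)]
  have key := mul_le_sqrt_of_escaping (Y := fun τ => X (t₀ - τ)) (P := fun τ => Ξ (t₀ - τ))
    (g := fun τ => a (t₀ - τ) (X (t₀ - τ)))
    (Q := fun τ => -(ContinuousLinearMap.adjoint (fderiv ℝ (a (t₀ - τ)) (X (t₀ - τ)))
      (Ξ (t₀ - τ) - a (t₀ - τ) (X (t₀ - τ)))))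
    (x := x) (η := lam • ξ) hC₀.le hC₁.le hR.le hA0 hlam1 he0 he1 hc hD
    (fun τ => (hd (t₀ - τ)).1.comp_const_sub t₀ τ)
    (fun τ => (hd (t₀ - τ)).2.comp_const_sub t₀ τ)
    (fun τ => h₀ _ _)
    (fun τ => by
      rw [norm_neg]
      refine (ContinuousLinearMap.le_opNorm _ _).trans ?_
      rw [LinearIsometryEquiv.norm_map]
      gcongr
      exact h₁ _ _)
    (by simpa using hX0) (by simpa using hΞ0) (hKR x hx)
    (by rw [hnorm, mul_comm lam]; gcongr) (by rw [hnorm, mul_comm lam]; gcongr) hl1 hl2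
    (t₀ - s) (by linarith) (by linarith)
  rw [abs_of_nonpos (by linarith), neg_sub]
  simpa using key

theorem rpow_neg_mul_rpow_le {j τ t lam D p k μ ν : ℝ} (hj : 1 ≤ j) (hτ : 0 ≤ τ) (hτt : τ ≤ t)
    (hlam : 1 ≤ lam) (hD : 0 ≤ D) (hp : 0 ≤ p) (hk : 0 ≤ k) (h : lam * τ ≤ D * j)
    (hμ : μ + ν ≤ min p k) :
    j ^ (-p) * τ ^ k * lam ^ μ ≤ D ^ min p k * t ^ (k - min p k) * lam ^ (-ν) := by
  set q := min p k
  have hq : 0 ≤ q := le_min hp hk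
  have hqp : q ≤ p := min_le_left _ _
  have hqk : q ≤ k := min_le_right _ _
  have hj0 : 0 < j := by linarith
  have hl0 : 0 < lam := by linarith
  have h1 : j ^ (-p) ≤ j ^ (-q) := Real.rpow_le_rpow_of_exponent_le hj (by linarith)
  have h2 : τ ^ k = τ ^ q * τ ^ (k - q) := by
    rw [← Real.rpow_add_of_nonneg hτ hq (by linarith)]; congr 1; ring
  have h3 : τ ^ (k - q) ≤ t ^ (k - q) := Real.rpow_le_rpow hτ hτt (by linarith)
  have h4 : τ ^ q ≤ D ^ q * j ^ q * lam ^ (-q) := by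
    rw [Real.rpow_neg hl0.le, ← div_eq_mul_inv, le_div_iff₀ (by positivity),
      ← Real.mul_rpow hτ hl0.le, ← Real.mul_rpow hD hj0.le, mul_comm τ]
    exact Real.rpow_le_rpow (by positivity) h hq
  have ht : 0 ≤ t := hτ.trans hτt
  calc j ^ (-p) * τ ^ k * lam ^ μ
      ≤ j ^ (-q) * (D ^ q * j ^ q * lam ^ (-q) * t ^ (k - q)) * lam ^ μ := by
        rw [h2]; gcongr
    _ = D ^ q * t ^ (k - q) * (j ^ (-q) * j ^ q) * (lam ^ (-q) * lam ^ μ) := by ring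
    _ = D ^ q * t ^ (k - q) * lam ^ (-q + μ) := by
        rw [← Real.rpow_add hj0, ← Real.rpow_add hl0]; simp
    _ ≤ _ := by
        gcongr
        linarith

/-- **Key estimate (3.6).** For multi-indices `β + γ = α`, `|α| ≥ 2`,
`sup_{s∈[0,t₀]} (⟨x*_s⟩^{1+ε+ρ-|α|} |s-t₀|^{|β|}) λ^{b(|β|-|γ|)} ≤ C λ^{-2b}`. -/
theorem sup_estimate_along_flow
    (n : ℕ) (hn : 2 ≤ n) (a : ℝ → V n → V n) (ρ : ℝ) (hρ : ρ < 1)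
    (hA : AssumptionA a ρ) (b ε : ℝ) (hb : b = min (1/8 : ℝ) ((1 - ρ) / 8))
    (hε : ε = (1 - ρ) / 2)
    (t₀ : ℝ) (ht₀ : 0 < t₀) (A : ℝ) (hA1 : 1 ≤ A) (x₀ ξ₀ : V n)
    (K : Set (V n)) (hK : K ∈ nhds x₀) (hKbdd : Bornology.IsBounded K)
    (Γ : Set (V n)) (hΓ : IsConicNbhd Γ ξ₀) :
    ∀ α β γ : Fin n → ℕ, 2 ≤ msize α → β + γ = α →
      ∃ C : ℝ, 0 < C ∧ ∃ lam₀ : ℝ, 1 ≤ lam₀ ∧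
        ∀ lam : ℝ, lam₀ ≤ lam → ∀ x ∈ K, ∀ ξ ∈ Γ, A⁻¹ ≤ ‖ξ‖ → ‖ξ‖ ≤ A →
        ∀ X Ξ : ℝ → V n, IsHamFlow a t₀ x (lam • ξ) X Ξ →
        ∀ s : ℝ, 0 ≤ s → s ≤ t₀ →
          jap (X s) (1 + ε + ρ - msize α) * |s - t₀| ^ (msize β) *
              lam ^ (b * ((msize β : ℝ) - (msize γ : ℝ)))
            ≤ C * lam ^ (-(2 * b)) := by
  intro α β γ hα hαβ
  have hsum : msize β + msize γ = msize α := by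
    simp only [msize, ← hαβ, Pi.add_apply, Finset.sum_add_distrib]
  obtain ⟨D, hD, lam₀, hlam₀, hflow⟩ := hA.exists_flow_lower_bound hρ ht₀ hA1 hKbdd
  have hmR : (msize β : ℝ) + msize γ = msize α := by exact_mod_cast hsum
  have hα' : (2 : ℝ) ≤ msize α := by exact_mod_cast hα
  set p : ℝ := msize α - (1 + ε + ρ) with hp
  set k : ℝ := (msize β : ℝ) with hk
  have hk0 : 0 ≤ k := Nat.cast_nonneg _
  have hγ0 : (0 : ℝ) ≤ msize γ := Nat.cast_nonneg _
  have hb8 : b ≤ 1 / 8 := hb ▸ min_le_left _ _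
  have hbρ : b ≤ (1 - ρ) / 8 := hb ▸ min_le_right _ _
  have hb0 : 0 < b := by rw [hb]; exact lt_min (by norm_num) (by linarith)
  have hp0 : 0 ≤ p := by rw [hp, hε]; linarith
  have hexp : b * (k - msize γ) + 2 * b ≤ min p k := by
    refine le_min ?_ ?_ <;> nlinarith
  refine ⟨D ^ min p k * t₀ ^ (k - min p k), by positivity, lam₀, hlam₀, ?_⟩
  intro lam hlam x hx ξ _ hξ hξ' X Ξ hXΞ s hs0 hs
  have h := rpow_neg_mul_rpow_le (one_le_sqrt_one_add_sq ‖X s‖) (abs_nonneg (s - t₀))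
    (by rw [abs_of_nonpos (by linarith)]; linarith : |s - t₀| ≤ t₀) (hlam₀.trans hlam) hD.le
    hp0 hk0 (hflow lam hlam x hx ξ hξ hξ' X Ξ hXΞ s hs0 hs) hexp
  rw [hk, Real.rpow_natCast] at h
  rwa [jap_eq_sqrt_rpow, show 1 + ε + ρ - (msize α : ℝ) = -p by rw [hp]; ring]

end
end
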